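/- Let P₀, P ⊆ Λ₂. Then Φ⁽²⁾_{P₀}(P) ≤ 4^{|P|} |G|^{2|P|} e^{−β Δ_G |P \ P₀|}, where Δ_G := min_{g≠1} Re(χ(1) − χ(g)). -/

import Mathlib

open Classical SimpleGraph
open scoped BigOperators

noncomputable section

namespace LGT

/-- A site of `ℤ⁴`. -/
abbrev Site : Type := Fin 4 → ℤ

/-- The `i`-th coordinate unit vector. -/
def unit (i : Fin 4) : Site := fun j => if j = i then 1 else 0

lemma unit_apply_self (i : Fin 4) : unit i i = 1 := by simp [unit]

lemma unit_apply_nonneg (i j : Fin 4) : 0 ≤ unit i j := by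
  by_cases h : j = i <;> simp [unit, h]

lemma unit_ne_zero (i : Fin 4) : unit i ≠ 0 := by
  intro h
  have h1 := congrFun h i
  rw [unit_apply_self] at h1
  exact one_ne_zero h1

/-- The lattice `Λ = ([a₁,b₁] × ⋯ × [a₄,b₄]) ∩ ℤ⁴`, with all side lengths equal. -/
structure Box where
  a : Fin 4 → ℤ
  b : Fin 4 → ℤ
  side_eq : ∀ i j : Fin 4, b i - a i = b j - a j

/-- Membership of a site in the lattice `Λ`. -/
def Box.mem (Λ : Box) (x : Site) : Prop := ∀ i, Λ.a i ≤ x i ∧ x i ≤ Λ.b i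

/-- The set of vertices `Λ₀` of the lattice. -/
abbrev VSite (Λ : Box) : Type := {x : Site // Λ.mem x}

lemma not_both {x y : Site} {i j : Fin 4} (h1 : y = x + unit i) (h2 : x = y + unit j) :
    False := by
  subst h1
  rw [add_assoc] at h2
  have h3 : unit i + unit j = 0 := left_eq_add.mp h2
  have h4 := congrFun h3 i
  rw [Pi.add_apply, Pi.zero_apply, unit_apply_self] at h4
  have h5 : (0:ℤ) ≤ unit j i := unit_apply_nonneg j i
  omega

/-- The 1-skeleton `S₁(Λ)` of the lattice, as a graph on the vertices of `Λ`:
two vertices are adjacent iff they differ by a coordinate unit vector. -/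
def latticeGraph (Λ : Box) : SimpleGraph (VSite Λ) where
  Adj u v := ∃ i : Fin 4, (v : Site) = (u : Site) + unit i ∨ (u : Site) = (v : Site) + unit i
  symm := by
    constructor
    rintro u v ⟨i, h | h⟩
    · exact ⟨i, Or.inr h⟩
    · exact ⟨i, Or.inl h⟩
  loopless := by
    constructor
    rintro u ⟨i, h | h⟩ <;> exact unit_ne_zero i (left_eq_add.mp h)

/-- The set `Λ₁` of positively oriented nearest-neighbour edges of `Λ`:
an edge is a pair (base site, direction) whose endpoints both lie in `Λ`. -/
abbrev PEdge (Λ : Box) : Type :=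
  {e : Site × Fin 4 // Λ.mem e.1 ∧ Λ.mem (e.1 + unit e.2)}

/-- The initial vertex of a positively oriented edge. -/
def PEdge.v0 {Λ : Box} (e : PEdge Λ) : VSite Λ := ⟨e.1.1, e.2.1⟩

/-- The final vertex of a positively oriented edge. -/
def PEdge.v1 {Λ : Box} (e : PEdge Λ) : VSite Λ := ⟨e.1.1 + unit e.1.2, e.2.2⟩

/-- Edge configurations `σ ∈ G^{Λ₁}`. -/
abbrev EdgeConf (Λ : Box) (G : Type*) : Type _ := PEdge Λ → G

variable {G : Type*} [Group G]

/-- The value of an edge configuration on an oriented edge `(u, v)`: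
`σ_e` on positively oriented edges, `σ_e⁻¹` on negatively oriented ones. -/
def oval {Λ : Box} (σ : EdgeConf Λ G) (u v : VSite Λ) : G :=
  if h : ∃ i : Fin 4, (v : Site) = (u : Site) + unit i then
    σ ⟨((u : Site), h.choose), u.2, by rw [← h.choose_spec]; exact v.2⟩
  else if h' : ∃ i : Fin 4, (u : Site) = (v : Site) + unit i then
    (σ ⟨((v : Site), h'.choose), v.2, by rw [← h'.choose_spec]; exact u.2⟩)⁻¹
  else 1

/-- The holonomy `σ_γ = σ_{e₁} ⋯ σ_{eₙ}` of an edge configuration along a walk. -/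
def hol {Λ : Box} (σ : EdgeConf Λ G) {u v : VSite Λ}
    (w : (latticeGraph Λ).Walk u v) : G :=
  (w.darts.map fun d => oval σ d.toProd.1 d.toProd.2).prod

@[simp] lemma hol_nil {Λ : Box} (σ : EdgeConf Λ G) {u : VSite Λ} :
    hol σ (SimpleGraph.Walk.nil : (latticeGraph Λ).Walk u u) = 1 := by simp [hol]

lemma hol_cons {Λ : Box} (σ : EdgeConf Λ G) {u m v : VSite Λ}
    (h : (latticeGraph Λ).Adj u m) (q : (latticeGraph Λ).Walk m v) :
    hol σ (SimpleGraph.Walk.cons h q) = oval σ u m * hol σ q := by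
  simp [hol]

lemma hol_append {Λ : Box} (σ : EdgeConf Λ G) {u v w : VSite Λ}
    (p : (latticeGraph Λ).Walk u v) (q : (latticeGraph Λ).Walk v w) :
    hol σ (p.append q) = hol σ p * hol σ q := by
  simp [hol, SimpleGraph.Walk.darts_append]

lemma oval_mul_oval {Λ : Box} (σ : EdgeConf Λ G) {u v : VSite Λ}
    (h : (latticeGraph Λ).Adj u v) : oval σ u v * oval σ v u = 1 := by
  obtain ⟨i, hi | hi⟩ := h
  · have h1 : ∃ k : Fin 4, (v : Site) = (u : Site) + unit k := ⟨i, hi⟩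
    have h2 : ¬ ∃ k : Fin 4, (u : Site) = (v : Site) + unit k := by
      rintro ⟨k, hk⟩; exact not_both hi hk
    simp only [oval]
    rw [dif_pos h1, dif_neg h2, dif_pos h1]
    exact mul_inv_cancel _
  · have h1 : ∃ k : Fin 4, (u : Site) = (v : Site) + unit k := ⟨i, hi⟩
    have h2 : ¬ ∃ k : Fin 4, (v : Site) = (u : Site) + unit k := by
      rintro ⟨k, hk⟩; exact not_both hk hi
    simp only [oval]
    rw [dif_neg h2, dif_pos h1, dif_pos h1]
    exact inv_mul_cancel _

/-- One step of combinatorial homotopy of walks in the 1-skeleton: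
inserting or removing a backtracking `e e⁻¹`. -/
inductive HStep {Λ : Box} :
    {u v : VSite Λ} → (latticeGraph Λ).Walk u v → (latticeGraph Λ).Walk u v → Prop
  | mk {u x y v : VSite Λ} (p : (latticeGraph Λ).Walk u x) (h : (latticeGraph Λ).Adj x y)
      (q : (latticeGraph Λ).Walk x v) :
      HStep (p.append (SimpleGraph.Walk.cons h (SimpleGraph.Walk.cons h.symm q)))
        (p.append q)

/-- Two walks in the 1-skeleton are homotopic if they differ by finitely many
insertions/removals of backtrackings.  The equivalence classes of closed walks based
at `x₀` are exactly the elements of the fundamental group `π₁(S₁(Λ), x₀)`. -/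
def Homotopic {Λ : Box} {u v : VSite Λ}
    (w₁ w₂ : (latticeGraph Λ).Walk u v) : Prop :=
  Relation.EqvGen (@HStep Λ u v) w₁ w₂

lemma hol_of_hstep {Λ : Box} (σ : EdgeConf Λ G) {u v : VSite Λ}
    {w₁ w₂ : (latticeGraph Λ).Walk u v} (h : HStep w₁ w₂) : hol σ w₁ = hol σ w₂ := by
  cases h with
  | mk p had q =>
    simp only [hol_append, hol_cons, ← mul_assoc]
    rw [mul_assoc (hol σ p), oval_mul_oval σ had, mul_one]

lemma hol_homotopic {Λ : Box} (σ : EdgeConf Λ G) {u v : VSite Λ}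
    {w₁ w₂ : (latticeGraph Λ).Walk u v} (h : Homotopic w₁ w₂) : hol σ w₁ = hol σ w₂ := by
  induction h with
  | rel _ _ hs => exact hol_of_hstep σ hs
  | refl _ => rfl
  | symm _ _ _ ih => exact ih.symm
  | trans _ _ _ _ _ ih₁ ih₂ => exact ih₁.trans ih₂

/-- The set `Ω = Hom(π₁(S₁(Λ), x₀), G)` of homomorphisms from the fundamental group
of the 1-skeleton based at `x₀` to `G`, modelled as functions on closed walks at `x₀`
that are homotopy invariant and multiplicative under concatenation. -/
structure Hom (Λ : Box) (x₀ : VSite Λ) (G : Type*) [Group G] where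
  toFun : (latticeGraph Λ).Walk x₀ x₀ → G
  invariant : ∀ w₁ w₂ : (latticeGraph Λ).Walk x₀ x₀, Homotopic w₁ w₂ → toFun w₁ = toFun w₂
  map_mul : ∀ w₁ w₂ : (latticeGraph Λ).Walk x₀ x₀, toFun (w₁.append w₂) = toFun w₁ * toFun w₂

/-- The map `ψ_{x₀} : G^{Λ₁} → Ω` sending an edge configuration to the induced
homomorphism of the fundamental group, given by holonomy along loops. -/
def psi (Λ : Box) (x₀ : VSite Λ) (σ : EdgeConf Λ G) : Hom Λ x₀ G where
  toFun := hol σ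
  invariant := fun _ _ h => hol_homotopic σ h
  map_mul := fun w₁ w₂ => hol_append σ w₁ w₂


/-- The set `Λ₂` of plaquettes of `Λ`: unit squares, given by a base site and two
distinct directions, all four of whose corners (hence all four boundary edges) lie in `Λ`. -/
abbrev Plaq (Λ : Box) : Type :=
  {q : Site × Fin 4 × Fin 4 //
    q.2.1 < q.2.2 ∧ Λ.mem q.1 ∧ Λ.mem (q.1 + unit q.2.1) ∧
    Λ.mem (q.1 + unit q.2.1 + unit q.2.2) ∧ Λ.mem (q.1 + unit q.2.2)}

namespace Plaq

variable {Λ : Box}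

/-- First corner `x₁` of a plaquette. -/
def c0 (p : Plaq Λ) : VSite Λ := ⟨p.1.1, p.2.2.1⟩
/-- Second corner `x₂` of a plaquette. -/
def c1 (p : Plaq Λ) : VSite Λ := ⟨p.1.1 + unit p.1.2.1, p.2.2.2.1⟩
/-- Third corner `x₃` of a plaquette. -/
def c2 (p : Plaq Λ) : VSite Λ := ⟨p.1.1 + unit p.1.2.1 + unit p.1.2.2, p.2.2.2.2.1⟩
/-- Fourth corner `x₄` of a plaquette. -/
def c3 (p : Plaq Λ) : VSite Λ := ⟨p.1.1 + unit p.1.2.2, p.2.2.2.2.2⟩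

/-- A site is a corner (vertex) of the plaquette. -/
def isCorner (p : Plaq Λ) (x : Site) : Prop :=
  x = (p.c0 : Site) ∨ x = (p.c1 : Site) ∨ x = (p.c2 : Site) ∨ x = (p.c3 : Site)

lemma adj01 (p : Plaq Λ) : (latticeGraph Λ).Adj p.c0 p.c1 := ⟨p.1.2.1, Or.inl rfl⟩
lemma adj12 (p : Plaq Λ) : (latticeGraph Λ).Adj p.c1 p.c2 := ⟨p.1.2.2, Or.inl rfl⟩
lemma adj23 (p : Plaq Λ) : (latticeGraph Λ).Adj p.c2 p.c3 :=
  ⟨p.1.2.1, Or.inr (add_right_comm p.1.1 (unit p.1.2.1) (unit p.1.2.2))⟩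
lemma adj30 (p : Plaq Λ) : (latticeGraph Λ).Adj p.c3 p.c0 := ⟨p.1.2.2, Or.inr rfl⟩

end Plaq

/-- The counter-clockwise boundary loop `γ_p : x₁ → x₂ → x₃ → x₄ → x₁` of a plaquette. -/
def plaqWalk {Λ : Box} (p : Plaq Λ) : (latticeGraph Λ).Walk p.c0 p.c0 :=
  SimpleGraph.Walk.cons p.adj01 (SimpleGraph.Walk.cons p.adj12
    (SimpleGraph.Walk.cons p.adj23 (SimpleGraph.Walk.cons p.adj30 SimpleGraph.Walk.nil)))

variable {G : Type*} [Group G]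

/-- The plaquette variable `σ_p`: the holonomy of `σ` around the boundary of `p`. -/
def holP {Λ : Box} (σ : EdgeConf Λ G) (p : Plaq Λ) : G := hol σ (plaqWalk p)

/-- The support of an edge configuration: the plaquettes `p` with `σ_p ≠ 1`. -/
def esupp {Λ : Box} (σ : EdgeConf Λ G) : Set (Plaq Λ) := {p | holP σ p ≠ 1}

/-- The character `χ = Tr ρ` of a unitary representation `ρ` of `G` of dimension `d`. -/
def chi {G : Type*} [Group G] {d : ℕ} (ρ : G →* Matrix.unitaryGroup (Fin d) ℂ) (g : G) : ℂ :=
  Matrix.trace ((ρ g : Matrix (Fin d) (Fin d) ℂ))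

/-- `Δ_G := min_{g ≠ 1} Re (χ(1) - χ(g))`. -/
def DeltaG (G : Type*) [Group G] (χ : G → ℂ) : ℝ :=
  sInf ((fun g => (χ 1 - χ g).re) '' {g : G | g ≠ 1})

/-- `φ_β(g) = exp(-β Re(χ(1) - χ(g)))`. -/
def phiB {G : Type*} [Group G] (χ : G → ℂ) (β : ℝ) (g : G) : ℝ :=
  Real.exp (-(β * (χ 1 - χ g).re))

/-- The Wilson action `S_Λ(σ) = Σ_{p ∈ Λ₂} Re (χ(1) - χ(σ_p))`. -/
def action (Λ : Box) (χ : G → ℂ) (σ : EdgeConf Λ G) : ℝ :=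
  ∑ᶠ p : Plaq Λ, (χ 1 - χ (holP σ p)).re

/-- The partition function `Z_{Λ,β}` of the lattice gauge theory. -/
def muZ (Λ : Box) (G : Type*) [Group G] (χ : G → ℂ) (β : ℝ) : ℝ :=
  ∑ᶠ σ : EdgeConf Λ G, Real.exp (-(β * action Λ χ σ))

/-- The probability `μ_{Λ,β}(σ) = Z⁻¹ e^{-β S_Λ(σ)}` of an edge configuration. -/
def muP (Λ : Box) (χ : G → ℂ) (β : ℝ) (σ : EdgeConf Λ G) : ℝ :=
  Real.exp (-(β * action Λ χ σ)) / muZ Λ G χ β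

/-- Expectation `E[f(Σ)]` for `Σ ∼ μ_{Λ,β}`. -/
def muE (Λ : Box) (χ : G → ℂ) (β : ℝ) (f : EdgeConf Λ G → ℂ) : ℂ :=
  ∑ᶠ σ : EdgeConf Λ G, (muP Λ χ β σ : ℂ) * f σ

/-- Covariance `Cov(f(Σ), g(Σ))` for `Σ ∼ μ_{Λ,β}`. -/
def muCov (Λ : Box) (χ : G → ℂ) (β : ℝ) (f g : EdgeConf Λ G → ℂ) : ℂ :=
  muE Λ χ β (fun σ => f σ * g σ) - muE Λ χ β f * muE Λ χ β g

section HomSide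

variable (Λ : Box) (x₀ : VSite Λ)

/-- Given fixed paths `ℓ(x₀,x)` and a closed loop `γ` based at `u`, the loop
`ξ_γ = ℓ(x₀,u) γ ℓ(x₀,u)⁻¹ ∈ π₁(S₁(Λ), x₀)` (as a based closed walk). -/
def xiLoop (ℓb : ∀ x : VSite Λ, (latticeGraph Λ).Walk x₀ x) {u : VSite Λ}
    (γ : (latticeGraph Λ).Walk u u) : (latticeGraph Λ).Walk x₀ x₀ :=
  (ℓb u).append (γ.append (ℓb u).reverse)

variable {Λ x₀}

/-- `ψ(ξ_γ)` for a homomorphism `ψ ∈ Ω` and a closed loop `γ`. -/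
def evalLoop (ψ : Hom Λ x₀ G) (ℓb : ∀ x : VSite Λ, (latticeGraph Λ).Walk x₀ x)
    {u : VSite Λ} (γ : (latticeGraph Λ).Walk u u) : G :=
  ψ.toFun (xiLoop Λ x₀ ℓb γ)

/-- `ψ(ξ_p)` for a plaquette `p`. -/
def evalP (ψ : Hom Λ x₀ G) (ℓb : ∀ x : VSite Λ, (latticeGraph Λ).Walk x₀ x)
    (p : Plaq Λ) : G :=
  evalLoop ψ ℓb (plaqWalk p)

/-- The support `supp(ψ) = {p ∈ Λ₂ : ψ(ξ_p) ≠ 1}` of a homomorphism. -/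
def hsupp (ψ : Hom Λ x₀ G) (ℓb : ∀ x : VSite Λ, (latticeGraph Λ).Walk x₀ x) :
    Set (Plaq Λ) :=
  {p | evalP ψ ℓb p ≠ 1}

variable (Λ x₀)

/-- The (unnormalized) weight `∏_{p ∈ Λ₂} φ_β(ψ(ξ_p))` of a homomorphism. -/
def nuW (χ : G → ℂ) (β : ℝ) (ℓb : ∀ x : VSite Λ, (latticeGraph Λ).Walk x₀ x)
    (ψ : Hom Λ x₀ G) : ℝ :=
  ∏ᶠ p : Plaq Λ, phiB χ β (evalP ψ ℓb p)

/-- The normalizing constant `Z^ν_{Λ,β}`. -/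
def nuZ (G : Type*) [Group G] (χ : G → ℂ) (β : ℝ)
    (ℓb : ∀ x : VSite Λ, (latticeGraph Λ).Walk x₀ x) : ℝ :=
  ∑ᶠ ψ : Hom Λ x₀ G, nuW Λ x₀ χ β ℓb ψ

/-- The probability `ν_{Λ,β}(ψ)` of a homomorphism. -/
def nuP (χ : G → ℂ) (β : ℝ) (ℓb : ∀ x : VSite Λ, (latticeGraph Λ).Walk x₀ x)
    (ψ : Hom Λ x₀ G) : ℝ :=
  nuW Λ x₀ χ β ℓb ψ / nuZ Λ x₀ G χ β ℓb

/-- Expectation `E[h(Ψ)]` for `Ψ ∼ ν_{Λ,β}`. -/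
def nuE (χ : G → ℂ) (β : ℝ) (ℓb : ∀ x : VSite Λ, (latticeGraph Λ).Walk x₀ x)
    (h : Hom Λ x₀ G → ℂ) : ℂ :=
  ∑ᶠ ψ : Hom Λ x₀ G, (nuP Λ x₀ χ β ℓb ψ : ℂ) * h ψ

/-- Covariance `Cov(h₁(Ψ), h₂(Ψ))` for `Ψ ∼ ν_{Λ,β}`. -/
def nuCov (χ : G → ℂ) (β : ℝ) (ℓb : ∀ x : VSite Λ, (latticeGraph Λ).Walk x₀ x)
    (h₁ h₂ : Hom Λ x₀ G → ℂ) : ℂ :=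
  nuE Λ x₀ χ β ℓb (fun ψ => h₁ ψ * h₂ ψ) - nuE Λ x₀ χ β ℓb h₁ * nuE Λ x₀ χ β ℓb h₂

/-- For `Ψ₁, Ψ₂` i.i.d. `∼ ν_{Λ,β}`, the probability `P((Ψ₁,Ψ₂) ∈ S)`. -/
def nuP2 (χ : G → ℂ) (β : ℝ) (ℓb : ∀ x : VSite Λ, (latticeGraph Λ).Walk x₀ x)
    (S : Set (Hom Λ x₀ G × Hom Λ x₀ G)) : ℝ :=
  ∑ᶠ pr ∈ S, nuP Λ x₀ χ β ℓb pr.1 * nuP Λ x₀ χ β ℓb pr.2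

end HomSide

/-- Conjugacy invariance: `f(h₁⁻¹g₁h₁, …, h_k⁻¹g_kh_k) = f(g₁, …, g_k)`. -/
def ConjInvariant {G : Type*} [Group G] {k : ℕ} (f : (Fin k → G) → ℂ) : Prop :=
  ∀ g h : Fin k → G, f (fun i => (h i)⁻¹ * g i * h i) = f g

/-- The sup norm `‖f‖_∞` of a complex-valued function. -/
def supNorm {α : Type*} (f : α → ℂ) : ℝ := ⨆ x, ‖f x‖


/-- A rectangle `B = [x₁,y₁] × ⋯ × [x₄,y₄]` contained in `Λ` (degenerate sides allowed). -/
structure Rect (Λ : Box) where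
  lo : Fin 4 → ℤ
  hi : Fin 4 → ℤ
  lo_le_hi : ∀ i, lo i ≤ hi i
  a_le_lo : ∀ i, Λ.a i ≤ lo i
  hi_le_b : ∀ i, hi i ≤ Λ.b i

namespace Rect

variable {Λ : Box}

/-- A site is a vertex of the rectangle. -/
def memV (B : Rect Λ) (x : Site) : Prop := ∀ i, B.lo i ≤ x i ∧ x i ≤ B.hi i

/-- A plaquette is contained in the rectangle (all four corners are vertices of it). -/
def plaqIn (B : Rect Λ) (p : Plaq Λ) : Prop :=
  B.memV (p.c0 : Site) ∧ B.memV (p.c1 : Site) ∧ B.memV (p.c2 : Site) ∧ B.memV (p.c3 : Site)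

/-- The set of plaquettes contained in the rectangle. -/
def plaqSet (B : Rect Λ) : Set (Plaq Λ) := {p | B.plaqIn p}

/-- `|B|`: the number of plaquettes contained in the rectangle. -/
def plaqCard (B : Rect Λ) : ℕ := Nat.card B.plaqSet

end Rect

/-- A walk is contained in a rectangle if all its vertices are vertices of the rectangle. -/
def WalkInRect {Λ : Box} (B : Rect Λ) {u v : VSite Λ}
    (w : (latticeGraph Λ).Walk u v) : Prop :=
  ∀ x ∈ w.support, B.memV (x : Site)

/-- The four boundary edges of a plaquette (as ordered pairs of vertices). -/
def plaqEdges {Λ : Box} (p : Plaq Λ) : List (VSite Λ × VSite Λ) :=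
  [(p.c0, p.c1), (p.c1, p.c2), (p.c3, p.c2), (p.c0, p.c3)]

/-- `(u,v)` is an (unoriented) edge of the 2-complex generated by the plaquette set `Q`. -/
def edgeInComplex {Λ : Box} (Q : Set (Plaq Λ)) (u v : VSite Λ) : Prop :=
  ∃ p ∈ Q, (u, v) ∈ plaqEdges p ∨ (v, u) ∈ plaqEdges p

/-- `u` is a vertex of the 2-complex generated by the plaquette set `Q`. -/
def vertexInComplex {Λ : Box} (Q : Set (Plaq Λ)) (u : VSite Λ) : Prop :=
  ∃ p ∈ Q, u = p.c0 ∨ u = p.c1 ∨ u = p.c2 ∨ u = p.c3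

/-- A walk lies in the 2-complex generated by `Q` if all its vertices and edges do. -/
def WalkInComplex {Λ : Box} (Q : Set (Plaq Λ)) {u v : VSite Λ}
    (w : (latticeGraph Λ).Walk u v) : Prop :=
  (∀ x ∈ w.support, vertexInComplex Q x) ∧
  (∀ d ∈ w.darts, edgeInComplex Q d.toProd.1 d.toProd.2)

/-- One step of combinatorial homotopy of walks within the 2-complex generated by `Q`:
inserting/removing a backtracking along an edge of the complex, or inserting/removing the
boundary loop of a plaquette of the complex. -/
inductive CHStep {Λ : Box} (Q : Set (Plaq Λ)) :
    {u v : VSite Λ} → (latticeGraph Λ).Walk u v → (latticeGraph Λ).Walk u v → Prop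
  | back {u x y v : VSite Λ} (p : (latticeGraph Λ).Walk u x) (h : (latticeGraph Λ).Adj x y)
      (he : edgeInComplex Q x y) (q : (latticeGraph Λ).Walk x v) :
      CHStep Q (p.append (SimpleGraph.Walk.cons h (SimpleGraph.Walk.cons h.symm q)))
        (p.append q)
  | plaq {u v : VSite Λ} (pl : Plaq Λ) (hpl : pl ∈ Q)
      (w₁ : (latticeGraph Λ).Walk u pl.c0) (w₂ : (latticeGraph Λ).Walk pl.c0 v) :
      CHStep Q (w₁.append ((plaqWalk pl).append w₂)) (w₁.append w₂)

/-- Homotopy of walks within the 2-complex generated by `Q`. -/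
def CHomotopic {Λ : Box} (Q : Set (Plaq Λ)) {u v : VSite Λ}
    (w₁ w₂ : (latticeGraph Λ).Walk u v) : Prop :=
  Relation.EqvGen (@CHStep Λ Q u v) w₁ w₂

/-- A 2-complex (given by a plaquette set `Q`, together with all its edges and vertices)
is simply connected: it is path connected and every closed walk in it is null-homotopic
within it. -/
def SimplyConnectedC {Λ : Box} (Q : Set (Plaq Λ)) : Prop :=
  (∀ u v : VSite Λ, vertexInComplex Q u → vertexInComplex Q v →
     ∃ w : (latticeGraph Λ).Walk u v, WalkInComplex Q w) ∧
  (∀ u : VSite Λ, ∀ w : (latticeGraph Λ).Walk u u, WalkInComplex Q w →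
     CHomotopic Q w SimpleGraph.Walk.nil)

/-- The 2-complex `S₂(B)`: all plaquettes of the rectangle `B`. -/
def S2 {Λ : Box} (B : Rect Λ) : Set (Plaq Λ) := B.plaqSet

/-- A plaquette lies on the (topological) boundary of a rectangle. -/
def Plaq.onRectBoundary {Λ : Box} (B : Rect Λ) (p : Plaq Λ) : Prop :=
  B.plaqIn p ∧ ∃ k : Fin 4, k ≠ p.1.2.1 ∧ k ≠ p.1.2.2 ∧
    (p.1.1 k = B.lo k ∨ p.1.1 k = B.hi k)

/-- A plaquette lies on the boundary of the lattice `Λ`. -/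
def Plaq.onBoxBoundary {Λ : Box} (p : Plaq Λ) : Prop :=
  ∃ k : Fin 4, k ≠ p.1.2.1 ∧ k ≠ p.1.2.2 ∧ (p.1.1 k = Λ.a k ∨ p.1.1 k = Λ.b k)

/-- The 2-complex `∂S₂(B)`: plaquettes on the boundary of `B` but not on the boundary of `Λ`. -/
def bS2 {Λ : Box} (B : Rect Λ) : Set (Plaq Λ) :=
  {p | p.onRectBoundary B ∧ ¬ p.onBoxBoundary}

/-- The 2-complex `S₂ᶜ(B)`: all plaquettes of `Λ` not contained in `B`, together with `∂S₂(B)`. -/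
def S2c {Λ : Box} (B : Rect Λ) : Set (Plaq Λ) :=
  {p | ¬ B.plaqIn p} ∪ bS2 B

/-- `P₁, P₂` are well separated by the rectangle `B`. -/
def WellSeparated {Λ : Box} (B : Rect Λ) (P₁ P₂ : Set (Plaq Λ)) : Prop :=
  P₁ ⊆ S2 B ∧ P₂ ⊆ S2c B ∧ ∀ p ∈ P₁ ∪ P₂, p ∉ bS2 B

/-- A good rectangle: `S₂(B)`, `S₂ᶜ(B)` and `∂S₂(B)` are all simply connected. -/
def GoodRect {Λ : Box} (B : Rect Λ) : Prop :=
  SimplyConnectedC (S2 B) ∧ SimplyConnectedC (S2c B) ∧ SimplyConnectedC (bS2 B)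

/-- `P₁` is well separated from `P₂` by some good rectangle. -/
def WellSepGood {Λ : Box} (P₁ P₂ : Set (Plaq Λ)) : Prop :=
  ∃ B : Rect Λ, GoodRect B ∧ WellSeparated B P₁ P₂

/-- Union of a list of sets. -/
def unionList {α : Type*} (Ks : List (Set α)) : Set α := {x | ∃ K ∈ Ks, x ∈ K}

/-- `Ks` is a knot decomposition of the plaquette set `P`: a maximal partition
`P = K₁ ∪ ⋯ ∪ K_m` such that each `K_i` is well separated from `K_{i+1} ∪ ⋯ ∪ K_m`
by a good rectangle. -/
structure IsKnotDecomp {Λ : Box} (P : Set (Plaq Λ)) (Ks : List (Set (Plaq Λ))) : Prop where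
  union_eq : unionList Ks = P
  nonempty : ∀ K ∈ Ks, K.Nonempty
  pairwise_disjoint : Ks.Pairwise Disjoint
  sep : ∀ (n : ℕ) (hn : n + 1 < Ks.length),
    WellSepGood (Ks.get ⟨n, Nat.lt_of_succ_lt hn⟩) (unionList (Ks.drop (n + 1)))
  maximal : ∀ K ∈ Ks, ¬ ∃ K₁ K₂ : Set (Plaq Λ), K₁.Nonempty ∧ K₂.Nonempty ∧
    Disjoint K₁ K₂ ∧ K₁ ∪ K₂ = K ∧ WellSepGood K₁ K₂

/-- The collection `𝒦` of knots: all sets appearing in the (fixed) knot decomposition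
`KD P` of some plaquette set `P`. -/
def Knots {Λ : Box} (KD : Set (Plaq Λ) → List (Set (Plaq Λ))) : Set (Set (Plaq Λ)) :=
  {K | ∃ P : Set (Plaq Λ), K ∈ KD P}

/-- `GF(T)`: edge configurations equal to `1` on every edge of the graph `T`. -/
def GF {Λ : Box} (G : Type*) [Group G] (T : SimpleGraph (VSite Λ)) :
    Set (EdgeConf Λ G) :=
  {σ | ∀ e : PEdge Λ, T.Adj e.v0 e.v1 → σ e = 1}

/-- The 1-skeleton of the 2-complex generated by the plaquette set `Q`, as a graph. -/
def skel {Λ : Box} (Q : Set (Plaq Λ)) : SimpleGraph (VSite Λ) :=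
  SimpleGraph.fromRel (edgeInComplex Q)

/-- `T` is a spanning tree of the 1-skeleton `S₁(Λ)`. -/
def IsSpanningTree {Λ : Box} (T : SimpleGraph (VSite Λ)) : Prop :=
  T ≤ latticeGraph Λ ∧ T.IsTree

/-- `T` contains a spanning tree of the 2-complex generated by `Q`: any two vertices of the
complex are joined by a path using only edges lying both in `T` and in the complex. -/
def ContainsSpanningTreeOf {Λ : Box} (T : SimpleGraph (VSite Λ)) (Q : Set (Plaq Λ)) : Prop :=
  ∀ u v : VSite Λ, vertexInComplex Q u → vertexInComplex Q v → (T ⊓ skel Q).Reachable u v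

section Phi

variable (Λ : Box) (x₀ : VSite Λ) {G : Type*} [Group G]

/-- `supp_{P₀}(ψ₁, ψ₂) = supp(ψ₁) ∪ supp(ψ₂) ∪ P₀`. -/
def supp2 (ℓb : ∀ x : VSite Λ, (latticeGraph Λ).Walk x₀ x) (P₀ : Set (Plaq Λ))
    (ψ₁ ψ₂ : Hom Λ x₀ G) : Set (Plaq Λ) :=
  hsupp ψ₁ ℓb ∪ hsupp ψ₂ ℓb ∪ P₀

/-- The polymer counting function
`Φ²_{P₀}(P) = Σ_{ψ₁,ψ₂ : supp_{P₀}(ψ₁,ψ₂) = P} ∏_{p∈Λ₂} φ_β(ψ₁(ξ_p)) φ_β(ψ₂(ξ_p))`. -/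
def Phi2 (χ : G → ℂ) (β : ℝ) (ℓb : ∀ x : VSite Λ, (latticeGraph Λ).Walk x₀ x)
    (P₀ P : Set (Plaq Λ)) : ℝ :=
  ∑ᶠ pr : Hom Λ x₀ G × Hom Λ x₀ G,
    if supp2 Λ x₀ ℓb P₀ pr.1 pr.2 = P then
      ∏ᶠ p : Plaq Λ, phiB χ β (evalP pr.1 ℓb p) * phiB χ β (evalP pr.2 ℓb p)
    else 0

end Phi


section Swap

variable (Λ : Box) (x₀ : VSite Λ) (G : Type*) [Group G]

/-- Tuples of homomorphisms subordinate to the members of a list of plaquette sets. -/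
def TupleSpace (ℓb : ∀ x : VSite Λ, (latticeGraph Λ).Walk x₀ x)
    (Ks : List (Set (Plaq Λ))) : Type _ :=
  {t : Fin Ks.length → Hom Λ x₀ G // ∀ i, hsupp (t i) ℓb ⊆ Ks.get i}

/-- `P := supp(ψ₁) ∪ supp(ψ₂) ∪ B₁ ∪ B₂` for a pair of homomorphisms. -/
def bigP (ℓb : ∀ x : VSite Λ, (latticeGraph Λ).Walk x₀ x) (B₁ B₂ : Rect Λ)
    (pr : Hom Λ x₀ G × Hom Λ x₀ G) : Set (Plaq Λ) :=
  hsupp pr.1 ℓb ∪ hsupp pr.2 ℓb ∪ S2 B₁ ∪ S2 B₂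

/-- `B₁` and `B₂` lie in different knots of the knot decomposition of
`supp(ψ₁) ∪ supp(ψ₂) ∪ B₁ ∪ B₂`. -/
def inDiffKnots (KD : Set (Plaq Λ) → List (Set (Plaq Λ)))
    (ℓb : ∀ x : VSite Λ, (latticeGraph Λ).Walk x₀ x) (B₁ B₂ : Rect Λ)
    (pr : Hom Λ x₀ G × Hom Λ x₀ G) : Prop :=
  ∃ j₁ j₂ : Fin (KD (bigP Λ x₀ G ℓb B₁ B₂ pr)).length, j₁ ≠ j₂ ∧
    S2 B₁ ⊆ (KD (bigP Λ x₀ G ℓb B₁ B₂ pr)).get j₁ ∧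
    S2 B₂ ⊆ (KD (bigP Λ x₀ G ℓb B₁ B₂ pr)).get j₂

/-- The event `E(B₁,B₂) ⊆ Ω²`. -/
def Eset (KD : Set (Plaq Λ) → List (Set (Plaq Λ)))
    (ℓb : ∀ x : VSite Λ, (latticeGraph Λ).Walk x₀ x) (B₁ B₂ : Rect Λ) :
    Set (Hom Λ x₀ G × Hom Λ x₀ G) :=
  {pr | inDiffKnots Λ x₀ G KD ℓb B₁ B₂ pr}

/-- The swapping map `T : E(B₁,B₂) → E(B₁,B₂)` (extended by the identity off `E(B₁,B₂)`):
identify `ψ₁, ψ₂` with tuples via `Θ(P)`, exchange the coordinates of the knot containing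
`B₂`, and come back via `Θ(P)⁻¹`. -/
def swapT (KD : Set (Plaq Λ) → List (Set (Plaq Λ)))
    (ℓb : ∀ x : VSite Λ, (latticeGraph Λ).Walk x₀ x)
    (Θ : ∀ P : Set (Plaq Λ),
      {ψ : Hom Λ x₀ G // hsupp ψ ℓb ⊆ P} ≃ TupleSpace Λ x₀ G ℓb (KD P))
    (B₁ B₂ : Rect Λ) (pr : Hom Λ x₀ G × Hom Λ x₀ G) : Hom Λ x₀ G × Hom Λ x₀ G :=
  if h : inDiffKnots Λ x₀ G KD ℓb B₁ B₂ pr then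
    let P := bigP Λ x₀ G ℓb B₁ B₂ pr
    let j₂ : Fin (KD P).length := h.choose_spec.choose
    let t₁ := Θ P ⟨pr.1, fun p hp =>
      Set.mem_union_left _ (Set.mem_union_left _ (Set.mem_union_left _ hp))⟩
    let t₂ := Θ P ⟨pr.2, fun p hp =>
      Set.mem_union_left _ (Set.mem_union_left _ (Set.mem_union_right _ hp))⟩
    (((Θ P).symm ⟨Function.update t₁.1 j₂ (t₂.1 j₂), by
        intro i
        rcases eq_or_ne i j₂ with hi | hi
        · subst hi; rw [Function.update_self]; exact t₂.2 j₂
        · rw [Function.update_of_ne hi]; exact t₁.2 i⟩).1,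
     ((Θ P).symm ⟨Function.update t₂.1 j₂ (t₁.1 j₂), by
        intro i
        rcases eq_or_ne i j₂ with hi | hi
        · subst hi; rw [Function.update_self]; exact t₁.2 j₂
        · rw [Function.update_of_ne hi]; exact t₂.2 i⟩).1)
  else pr

end Swap

section Transport

lemma homotopic_reverse_append {Λ : Box} {u v : VSite Λ} (w : (latticeGraph Λ).Walk u v) :
    ∀ {s t : VSite Λ} (p : (latticeGraph Λ).Walk s v) (q : (latticeGraph Λ).Walk v t),
      Homotopic (p.append (w.reverse.append (w.append q))) (p.append q) := by
  induction w with
  | nil => exact fun p q => Relation.EqvGen.refl _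
  | cons h w ih =>
    intro s t p q
    have h1 := HStep.mk (p.append w.reverse) h.symm (w.append q)
    refine Relation.EqvGen.trans _ _ _ (Relation.EqvGen.rel _ _ ?_) (ih p q)
    simpa only [SimpleGraph.Walk.reverse_cons, ← SimpleGraph.Walk.append_assoc,
      SimpleGraph.Walk.cons_append, SimpleGraph.Walk.nil_append] using h1

variable {Λ : Box} {x₀ : VSite Λ}

lemma Hom.ext {ψ φ : Hom Λ x₀ G} (h : ∀ w, ψ.toFun w = φ.toFun w) : ψ = φ := by
  cases ψ
  cases φ
  congr
  exact funext h

lemma Hom.map_nil (ψ : Hom Λ x₀ G) : ψ.toFun SimpleGraph.Walk.nil = 1 := by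
  have h := ψ.map_mul SimpleGraph.Walk.nil SimpleGraph.Walk.nil
  simpa using h

lemma Hom.map_cancel (ψ : Hom Λ x₀ G) {u v : VSite Λ} (w : (latticeGraph Λ).Walk u v)
    (p : (latticeGraph Λ).Walk x₀ v) (q : (latticeGraph Λ).Walk v x₀) :
    ψ.toFun (p.append (w.reverse.append (w.append q))) = ψ.toFun (p.append q) :=
  ψ.invariant _ _ (homotopic_reverse_append w p q)

/-- The value of a homomorphism on the loop obtained by closing a walk up with the paths `ℓ`. -/
def transport (ψ : Hom Λ x₀ G) (ℓ : ∀ x : VSite Λ, (latticeGraph Λ).Walk x₀ x) {u v : VSite Λ}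
    (w : (latticeGraph Λ).Walk u v) : G :=
  ψ.toFun ((ℓ u).append (w.append (ℓ v).reverse))

variable (ψ : Hom Λ x₀ G) (ℓ : ∀ x : VSite Λ, (latticeGraph Λ).Walk x₀ x)

lemma transport_append {u v t : VSite Λ} (w : (latticeGraph Λ).Walk u v)
    (w' : (latticeGraph Λ).Walk v t) :
    transport ψ ℓ (w.append w') = transport ψ ℓ w * transport ψ ℓ w' := by
  unfold transport
  rw [← ψ.map_mul]
  have h := ψ.map_cancel (ℓ v) ((ℓ u).append w) (w'.append (ℓ t).reverse)
  simpa only [SimpleGraph.Walk.append_assoc] using h.symm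

lemma transport_cons {u v t : VSite Λ} (h : (latticeGraph Λ).Adj u v)
    (w : (latticeGraph Λ).Walk v t) :
    transport ψ ℓ (SimpleGraph.Walk.cons h w) =
      transport ψ ℓ (SimpleGraph.Walk.cons h SimpleGraph.Walk.nil) * transport ψ ℓ w := by
  rw [← transport_append]
  rfl

lemma transport_nil (u : VSite Λ) :
    transport ψ ℓ (SimpleGraph.Walk.nil : (latticeGraph Λ).Walk u u) = 1 := by
  have h := transport_append ψ ℓ (SimpleGraph.Walk.nil : (latticeGraph Λ).Walk u u)
    SimpleGraph.Walk.nil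
  simpa using h

lemma transport_symm {u v : VSite Λ} (h : (latticeGraph Λ).Adj u v) :
    transport ψ ℓ (SimpleGraph.Walk.cons h.symm SimpleGraph.Walk.nil) =
      (transport ψ ℓ (SimpleGraph.Walk.cons h SimpleGraph.Walk.nil))⁻¹ := by
  rw [eq_inv_iff_mul_eq_one, ← transport_append]
  have h1 := ψ.map_cancel (SimpleGraph.Walk.cons h SimpleGraph.Walk.nil) (ℓ v) (ℓ v).reverse
  refine Eq.trans ?_ (Eq.trans h1 (transport_nil ψ ℓ v))
  simp [transport]

lemma transport_eq_one_of_concat {u v : VSite Λ} (h : (latticeGraph Λ).Adj u v)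
    (hℓ : ℓ v = (ℓ u).concat h) :
    transport ψ ℓ (SimpleGraph.Walk.cons h SimpleGraph.Walk.nil) = 1 := by
  have h1 := ψ.map_cancel ((ℓ u).concat h).reverse SimpleGraph.Walk.nil SimpleGraph.Walk.nil
  rw [← ψ.map_nil]
  refine Eq.trans ?_ h1
  simp [transport, hℓ, SimpleGraph.Walk.concat_eq_append, SimpleGraph.Walk.reverse_append,
    ← SimpleGraph.Walk.append_assoc]

lemma transport_closed (hℓ : ψ.toFun (ℓ x₀) = 1) (w : (latticeGraph Λ).Walk x₀ x₀) :
    transport ψ ℓ w = ψ.toFun w := by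
  have h := ψ.map_cancel (ℓ x₀).reverse SimpleGraph.Walk.nil SimpleGraph.Walk.nil
  simp only [SimpleGraph.Walk.reverse_reverse, SimpleGraph.Walk.nil_append,
    SimpleGraph.Walk.append_nil, ψ.map_mul, hℓ, one_mul, ψ.map_nil] at h
  simp [transport, ψ.map_mul, hℓ, h]

/-- Changing the base paths conjugates the value of a homomorphism on a loop. -/
lemma transport_eq_one_iff (ℓ' : ∀ x : VSite Λ, (latticeGraph Λ).Walk x₀ x) {u : VSite Λ}
    (w : (latticeGraph Λ).Walk u u) : transport ψ ℓ w = 1 ↔ transport ψ ℓ' w = 1 := by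
  have key : ∀ ℓ ℓ' : ∀ x : VSite Λ, (latticeGraph Λ).Walk x₀ x,
      transport ψ ℓ w = 1 → transport ψ ℓ' w = 1 := by
    intro ℓ ℓ' h
    have h1 := ψ.map_cancel (ℓ u) (ℓ' u) (w.append (ℓ' u).reverse)
    have h2 := ψ.map_cancel (ℓ u) ((ℓ' u).append ((ℓ u).reverse.append ((ℓ u).append w)))
      (ℓ' u).reverse
    have h3 := ψ.map_cancel (ℓ u) (ℓ' u) (ℓ' u).reverse
    have h4 := ψ.map_cancel (ℓ' u).reverse SimpleGraph.Walk.nil SimpleGraph.Walk.nil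
    have h5 : ψ.toFun (((ℓ' u).append (ℓ u).reverse).append
        (((ℓ u).append (w.append (ℓ u).reverse)).append ((ℓ u).append (ℓ' u).reverse))) =
        transport ψ ℓ' w := by
      refine Eq.trans ?_ (h2.trans (Eq.trans ?_ h1)) <;>
        simp only [SimpleGraph.Walk.append_assoc]
    rw [← h5, ψ.map_mul, ψ.map_mul]
    change _ * (transport ψ ℓ w * _) = 1
    rw [h, one_mul, ← ψ.map_mul, ← ψ.map_nil]
    refine Eq.trans ?_ (h3.trans (Eq.trans ?_ h4)) <;>
      simp [SimpleGraph.Walk.append_assoc]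
  exact ⟨key ℓ ℓ', key ℓ' ℓ⟩

end Transport

section Comb

variable {Λ : Box}

/-- The corner of the lattice with smallest coordinates. -/
def Box.corner (Λ : Box) (x₀ : VSite Λ) : VSite Λ :=
  ⟨Λ.a, fun i => ⟨le_rfl, (x₀.2 i).1.trans (x₀.2 i).2⟩⟩

/-- `i` is the last direction in which `x` differs from the corner of the lattice. -/
def IsLastDir (x : VSite Λ) (i : Fin 4) : Prop :=
  Λ.a i < (x : Site) i ∧ ∀ j, i < j → (x : Site) j = Λ.a j

lemma IsLastDir.unique {x : VSite Λ} {i j : Fin 4} (hi : IsLastDir x i) (hj : IsLastDir x j) :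
    i = j := by
  rcases lt_trichotomy i j with h | h | h
  · exact absurd (hi.2 j h) hj.1.ne'
  · exact h
  · exact absurd (hj.2 i h) hi.1.ne'

lemma exists_isLastDir {x : VSite Λ} {k : Fin 4} (hk : Λ.a k < (x : Site) k) :
    ∃ i, k ≤ i ∧ IsLastDir x i := by
  have hmem : ∀ i, i ∈ Finset.univ.filter (fun i => Λ.a i < (x : Site) i) ↔
      Λ.a i < (x : Site) i := by simp
  refine ⟨_, Finset.le_max' _ k ((hmem k).2 hk), (hmem _).1 (Finset.max'_mem _ _), fun j hj => ?_⟩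
  by_contra hne
  exact hj.not_ge (Finset.le_max' _ j ((hmem j).2 (lt_of_le_of_ne (x.2 j).1 (Ne.symm hne))))

lemma mem_sub_unit {x : VSite Λ} {i : Fin 4} (h : Λ.a i < (x : Site) i) :
    Λ.mem ((x : Site) - unit i) := by
  intro j
  have hx := x.2 j
  by_cases hj : j = i
  · subst hj
    simp only [Pi.sub_apply, unit_apply_self]
    omega
  · simpa [unit, hj] using hx

/-- The predecessor of a vertex in a given direction. -/
def pred (x : VSite Λ) (i : Fin 4) (h : Λ.a i < (x : Site) i) : VSite Λ :=
  ⟨(x : Site) - unit i, mem_sub_unit h⟩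

lemma adj_pred (x : VSite Λ) (i : Fin 4) (h : Λ.a i < (x : Site) i) :
    (latticeGraph Λ).Adj (pred x i h) x :=
  ⟨i, Or.inl (by simp [pred])⟩

/-- The `ℓ¹` distance to the corner of the lattice. -/
def height (x : VSite Λ) : ℕ := (∑ j, ((x : Site) j - Λ.a j)).toNat

lemma height_pred_lt (x : VSite Λ) (i : Fin 4) (h : Λ.a i < (x : Site) i) :
    height (pred x i h) < height x := by
  have h1 : ∑ j, ((pred x i h : Site) j - Λ.a j) = ∑ j, ((x : Site) j - Λ.a j) - 1 := by
    have : ∑ j, unit i j = 1 := by simp [unit]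
    rw [← this, ← Finset.sum_sub_distrib]
    refine Finset.sum_congr rfl fun j _ => ?_
    simp only [pred, Pi.sub_apply]
    ring
  have h2 : 0 < ∑ j, ((x : Site) j - Λ.a j) :=
    Finset.sum_pos' (fun j _ => sub_nonneg.2 (x.2 j).1) ⟨i, Finset.mem_univ _, sub_pos.2 h⟩
  unfold height
  omega

/-- The path from the corner to `x` which moves along the coordinate directions in order. -/
def comb (x₀ : VSite Λ) (x : VSite Λ) : (latticeGraph Λ).Walk (Λ.corner x₀) x :=
  if h : ∃ i, IsLastDir x i then
    (comb x₀ (pred x h.choose h.choose_spec.1)).concat (adj_pred x h.choose h.choose_spec.1)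
  else
    (SimpleGraph.Walk.nil : (latticeGraph Λ).Walk (Λ.corner x₀) (Λ.corner x₀)).copy rfl (by
      apply Subtype.ext
      funext k
      by_contra hk
      obtain ⟨i, -, hi⟩ := exists_isLastDir (lt_of_le_of_ne (x.2 k).1 hk)
      exact h ⟨i, hi⟩)
termination_by height x
decreasing_by exact height_pred_lt x _ _

lemma comb_eq_concat (x₀ : VSite Λ) {x : VSite Λ} {i : Fin 4} (hi : IsLastDir x i) :
    comb x₀ x = (comb x₀ (pred x i hi.1)).concat (adj_pred x i hi.1) := by
  have h : ∃ i, IsLastDir x i := ⟨i, hi⟩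
  obtain rfl : h.choose = i := h.choose_spec.unique hi
  rw [comb, dif_pos h]

/-- Base paths at `x₀` through the corner of the lattice. -/
def combPath (x₀ x : VSite Λ) : (latticeGraph Λ).Walk x₀ x :=
  (comb x₀ x₀).reverse.append (comb x₀ x)

variable {x₀ : VSite Λ} (ψ φ : Hom Λ x₀ G)

lemma toFun_combPath : ψ.toFun (combPath x₀ x₀) = 1 := by
  have h := ψ.map_cancel (comb x₀ x₀) SimpleGraph.Walk.nil SimpleGraph.Walk.nil
  simpa [ψ.map_nil, combPath] using h

lemma transport_combPath_eq_one {x y : VSite Λ} {i : Fin 4} (h : (latticeGraph Λ).Adj x y)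
    (hy : (y : Site) = (x : Site) + unit i) (hx : ∀ j, i < j → (x : Site) j = Λ.a j) :
    transport ψ (combPath x₀) (SimpleGraph.Walk.cons h SimpleGraph.Walk.nil) = 1 := by
  have hi : IsLastDir y i := by
    refine ⟨?_, fun j hj => ?_⟩
    · have := (x.2 i).1
      rw [hy, Pi.add_apply, unit_apply_self]
      omega
    · rw [hy, Pi.add_apply, hx j hj]
      simp [unit, hj.ne']
  obtain rfl : pred y i hi.1 = x := Subtype.ext (by simp [pred, hy])
  apply transport_eq_one_of_concat
  simp only [combPath, comb_eq_concat x₀ hi, SimpleGraph.Walk.concat_eq_append,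
    SimpleGraph.Walk.append_assoc]

/-- In the comb gauge the plaquette variables determine the edge variables. -/
lemma transport_edge_eq
    (hP : ∀ p : Plaq Λ, transport ψ (combPath x₀) (plaqWalk p) =
      transport φ (combPath x₀) (plaqWalk p)) (n : ℕ) :
    ∀ {x y : VSite Λ} (i : Fin 4) (h : (latticeGraph Λ).Adj x y),
      (y : Site) = (x : Site) + unit i → height x = n →
      transport ψ (combPath x₀) (SimpleGraph.Walk.cons h SimpleGraph.Walk.nil) =
        transport φ (combPath x₀) (SimpleGraph.Walk.cons h SimpleGraph.Walk.nil) := by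
  induction n using Nat.strong_induction_on with
  | _ n ih =>
    intro x y i h hy hn
    by_cases hx : ∀ j, i < j → (x : Site) j = Λ.a j
    · rw [transport_combPath_eq_one ψ h hy hx, transport_combPath_eq_one φ h hy hx]
    · push Not at hx
      obtain ⟨k, hik, hk⟩ := hx
      obtain ⟨j, hkj, hj⟩ := exists_isLastDir (lt_of_le_of_ne (x.2 k).1 (Ne.symm hk))
      have hij : i < j := hik.trans_le hkj
      have hjy : Λ.a j < (y : Site) j := by
        rw [hy, Pi.add_apply]
        have := hj.1
        have := unit_apply_nonneg i j
        omega
      have e1 : (x : Site) - unit j + unit i = (y : Site) - unit j := by rw [hy]; abel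
      obtain ⟨p, rfl, rfl, rfl, rfl⟩ :
          ∃ p : Plaq Λ, p.c3 = x ∧ p.c2 = y ∧ p.1.2.1 = i ∧ p.1.2.2 = j :=
        ⟨⟨((x : Site) - unit j, i, j), hij, mem_sub_unit hj.1,
          by simpa only [e1] using mem_sub_unit hjy,
          by simpa only [e1, sub_add_cancel] using y.2,
          by simpa only [sub_add_cancel] using x.2⟩,
          Subtype.ext (sub_add_cancel _ _),
          Subtype.ext (by simp only [Plaq.c2, e1, sub_add_cancel]), rfl, rfl⟩
      have hlast : ∀ l, p.1.2.2 < l → (p.c0 : Site) l = Λ.a l := by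
        intro l hl
        have h1 := hj.2 l hl
        have h2 : (p.c3 : Site) l = (p.c0 : Site) l + unit p.1.2.2 l := rfl
        have h3 : unit p.1.2.2 l = 0 := by simp [unit, hl.ne']
        omega
      have hlast' : ∀ l, p.1.2.2 < l → (p.c1 : Site) l = Λ.a l := by
        intro l hl
        have h1 := hlast l hl
        have h2 : (p.c1 : Site) l = (p.c0 : Site) l + unit p.1.2.1 l := rfl
        have h3 : unit p.1.2.1 l = 0 := by simp [unit, (hij.trans hl).ne']
        omega
      have hlt : height p.c0 < n := by
        rw [← hn]
        have h1 : pred p.c3 _ hj.1 = p.c0 := Subtype.ext (add_sub_cancel_right _ _)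
        exact h1 ▸ height_pred_lt p.c3 _ hj.1
      have hbot := ih _ hlt _ p.adj01 rfl rfl
      have hp := hP p
      have expand : ∀ χ : Hom Λ x₀ G, transport χ (combPath x₀) (plaqWalk p) =
          transport χ (combPath x₀) (SimpleGraph.Walk.cons p.adj01 SimpleGraph.Walk.nil) *
          (transport χ (combPath x₀) (SimpleGraph.Walk.cons h SimpleGraph.Walk.nil))⁻¹ := by
        intro χ
        have h12 := transport_combPath_eq_one χ p.adj12 (i := p.1.2.2) rfl hlast'
        have h30 := transport_symm χ (combPath x₀) p.adj30.symm
        rw [transport_combPath_eq_one χ p.adj30.symm (i := p.1.2.2) rfl hlast, inv_one] at h30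
        rw [plaqWalk, transport_cons, transport_cons χ _ p.adj12, transport_cons χ _ p.adj23,
          h12, h30, one_mul, mul_one, ← transport_symm χ _ h]
      rw [expand, expand, hbot] at hp
      exact inv_injective (mul_left_cancel hp)

lemma transport_eq_of_plaqWalk
    (hP : ∀ p : Plaq Λ, transport ψ (combPath x₀) (plaqWalk p) =
      transport φ (combPath x₀) (plaqWalk p)) {u v : VSite Λ} (w : (latticeGraph Λ).Walk u v) :
    transport ψ (combPath x₀) w = transport φ (combPath x₀) w := by
  induction w with
  | nil => rw [transport_nil, transport_nil]
  | cons h w ih =>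
    rw [transport_cons, transport_cons φ, ih]
    congr 1
    obtain ⟨i, hi | hi⟩ := id h
    · exact transport_edge_eq ψ φ hP _ i h hi rfl
    · have h1 := transport_edge_eq ψ φ hP _ i h.symm hi rfl
      rw [transport_symm ψ _ h, transport_symm φ _ h] at h1
      exact inv_injective h1

lemma hom_eq_of_plaqWalk
    (hP : ∀ p : Plaq Λ, transport ψ (combPath x₀) (plaqWalk p) =
      transport φ (combPath x₀) (plaqWalk p)) : ψ = φ := by
  refine Hom.ext fun w => ?_
  rw [← transport_closed ψ (combPath x₀) (toFun_combPath ψ),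
    ← transport_closed φ (combPath x₀) (toFun_combPath φ)]
  exact transport_eq_of_plaqWalk ψ φ hP w

end Comb

section Counting

instance (Λ : Box) : Finite (Plaq Λ) := by
  have : Finite (Set.Icc Λ.a Λ.b) := (Set.finite_Icc Λ.a Λ.b).to_subtype
  refine Finite.of_injective
    (fun p : Plaq Λ => ((⟨p.1.1, fun i => (p.2.2.1 i).1, fun i => (p.2.2.1 i).2⟩, p.1.2) :
      Set.Icc Λ.a Λ.b × Fin 4 × Fin 4)) ?_
  rintro ⟨⟨x, d⟩, hp⟩ ⟨⟨y, e⟩, hq⟩ h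
  simpa [Subtype.ext_iff] using h

variable {Λ : Box} {x₀ : VSite Λ}

instance [Finite G] : Finite (Hom Λ x₀ G) :=
  Finite.of_injective (fun (ψ : Hom Λ x₀ G) (p : Plaq Λ) =>
    transport ψ (combPath x₀) (plaqWalk p)) fun ψ φ h => hom_eq_of_plaqWalk ψ φ (congrFun h)

/-- The number of homomorphisms supported in `P` is at most `|G|^|P|`. -/
lemma card_hsupp_subset_le [Finite G] (ℓb : ∀ x : VSite Λ, (latticeGraph Λ).Walk x₀ x)
    (P : Set (Plaq Λ)) :
    Nat.card {ψ : Hom Λ x₀ G // hsupp ψ ℓb ⊆ P} ≤ Nat.card G ^ Nat.card P := by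
  rw [← Nat.card_fun]
  refine Nat.card_le_card_of_injective
    (fun ψ (p : P) => transport ψ.1 (combPath x₀) (plaqWalk p.1)) ?_
  rintro ⟨ψ, hψ⟩ ⟨φ, hφ⟩ h
  refine Subtype.ext (hom_eq_of_plaqWalk ψ φ fun p => ?_)
  by_cases hp : p ∈ P
  · exact congrFun h ⟨p, hp⟩
  · have aux : ∀ χ : Hom Λ x₀ G, hsupp χ ℓb ⊆ P →
        transport χ (combPath x₀) (plaqWalk p) = 1 := fun χ hχ =>
      (transport_eq_one_iff χ _ ℓb _).2 (not_not.1 fun hne => hp (hχ hne))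
    rw [aux ψ hψ, aux φ hφ]

lemma card_supp2_eq_le [Finite G] (ℓb : ∀ x : VSite Λ, (latticeGraph Λ).Walk x₀ x)
    (P₀ P : Set (Plaq Λ)) :
    Nat.card {pr : Hom Λ x₀ G × Hom Λ x₀ G // supp2 Λ x₀ ℓb P₀ pr.1 pr.2 = P} ≤
      Nat.card G ^ (2 * Nat.card P) := by
  have h := card_hsupp_subset_le (G := G) ℓb P
  rw [two_mul, pow_add]
  refine le_trans ?_ (Nat.mul_le_mul h h)
  rw [← Nat.card_prod]
  refine Nat.card_le_card_of_injective
    (fun pr => (⟨pr.1.1, fun p hp => pr.2 ▸ Or.inl (Or.inl hp)⟩,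
      ⟨pr.1.2, fun p hp => pr.2 ▸ Or.inl (Or.inr hp)⟩)) ?_
  rintro ⟨⟨ψ₁, ψ₂⟩, h₁⟩ ⟨⟨φ₁, φ₂⟩, h₂⟩ h
  simpa [Subtype.ext_iff] using h

end Counting

section Weights

variable {d : ℕ} (ρ : G →* Matrix.unitaryGroup (Fin d) ℂ)

lemma chi_one_sub_re_nonneg (g : G) : 0 ≤ (chi ρ 1 - chi ρ g).re := by
  have h : ∀ i, ((ρ g : Matrix (Fin d) (Fin d) ℂ) i i).re ≤ 1 := fun i =>
    (Complex.re_le_norm _).trans (entry_norm_bound_of_unitary (ρ g).2 i i)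
  have h2 := Finset.sum_le_sum fun i (_ : i ∈ Finset.univ) => h i
  simpa [chi, Matrix.trace] using h2

lemma DeltaG_le [Finite G] (χ : G → ℂ) {g : G} (hg : g ≠ 1) : DeltaG G χ ≤ (χ 1 - χ g).re :=
  csInf_le (Set.toFinite _).bddBelow ⟨g, hg, rfl⟩

variable {β : ℝ}

lemma phiB_nonneg (χ : G → ℂ) (g : G) : 0 ≤ phiB χ β g := (Real.exp_pos _).le

lemma phiB_chi_le_one (hβ : 0 ≤ β) (g : G) : phiB (chi ρ) β g ≤ 1 :=
  Real.exp_le_one_iff.2 (neg_nonpos.2 (mul_nonneg hβ (chi_one_sub_re_nonneg ρ g)))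

lemma phiB_le_exp [Finite G] (hβ : 0 ≤ β) (χ : G → ℂ) {g : G} (hg : g ≠ 1) :
    phiB χ β g ≤ Real.exp (-(β * DeltaG G χ)) :=
  Real.exp_le_exp.2 (neg_le_neg (mul_le_mul_of_nonneg_left (DeltaG_le χ hg) hβ))

lemma finprod_phiB_le [Finite G] {Λ : Box} {x₀ : VSite Λ} (hβ : 0 ≤ β)
    (ℓb : ∀ x : VSite Λ, (latticeGraph Λ).Walk x₀ x) (P₀ : Set (Plaq Λ)) (ψ₁ ψ₂ : Hom Λ x₀ G) :
    ∏ᶠ p : Plaq Λ, phiB (chi ρ) β (evalP ψ₁ ℓb p) * phiB (chi ρ) β (evalP ψ₂ ℓb p) ≤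
      Real.exp (-(β * DeltaG G (chi ρ) *
        (Nat.card ↥(supp2 Λ x₀ ℓb P₀ ψ₁ ψ₂ \ P₀) : ℝ))) := by
  have := Fintype.ofFinite (Plaq Λ)
  rw [finprod_eq_prod_of_fintype]
  refine (Finset.prod_le_prod (g := fun p => if p ∈ supp2 Λ x₀ ℓb P₀ ψ₁ ψ₂ \ P₀ then
    Real.exp (-(β * DeltaG G (chi ρ))) else 1)
    (fun p _ => mul_nonneg (phiB_nonneg _ _) (phiB_nonneg _ _)) fun p _ => ?_).trans_eq ?_
  · split_ifs with hp
    · obtain ⟨(hp | hp) | hp, hp₀⟩ := hp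
      · exact (mul_le_of_le_one_right (phiB_nonneg _ _) (phiB_chi_le_one ρ hβ _)).trans
          (phiB_le_exp hβ _ hp)
      · exact (mul_le_of_le_one_left (phiB_nonneg _ _) (phiB_chi_le_one ρ hβ _)).trans
          (phiB_le_exp hβ _ hp)
      · exact absurd hp hp₀
    · exact mul_le_one₀ (phiB_chi_le_one ρ hβ _) (phiB_nonneg _ _) (phiB_chi_le_one ρ hβ _)
  · rw [Finset.prod_ite, Finset.prod_const_one, mul_one, Finset.prod_const, ← Real.exp_nat_mul,
      Nat.card_eq_fintype_card, Fintype.card_subtype]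
    congr 1
    ring

end Weights

/-- Lemma 6.6: `Φ⁽²⁾_{P₀}(P) ≤ 4^{|P|} |G|^{2|P|} e^{-β Δ_G |P \ P₀|}`. -/
theorem Phi2_le
    (Λ : Box) (x₀ : VSite Λ) (G : Type*) [Group G] [Fintype G] [Nontrivial G]
    {d : ℕ} (ρ : G →* Matrix.unitaryGroup (Fin d) ℂ)
    (β : ℝ) (hβ : 0 ≤ β)
    (ℓb : ∀ x : VSite Λ, (latticeGraph Λ).Walk x₀ x)
    (P₀ P : Set (Plaq Λ)) :
    Phi2 Λ x₀ (chi ρ) β ℓb P₀ P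
      ≤ 4 ^ Nat.card P * (Nat.card G : ℝ) ^ (2 * Nat.card P) *
          Real.exp (-(β * DeltaG G (chi ρ) * (Nat.card ↥(P \ P₀) : ℝ))) := by
  have := Fintype.ofFinite (Hom Λ x₀ G)
  rw [Phi2, finsum_eq_sum_of_fintype, ← Finset.sum_filter]
  refine (Finset.sum_le_card_nsmul _ _ (Real.exp (-(β * DeltaG G (chi ρ) *
    (Nat.card ↥(P \ P₀) : ℝ)))) fun pr hpr => ?_).trans ?_
  · have h := finprod_phiB_le ρ hβ ℓb P₀ pr.1 pr.2
    rwa [(Finset.mem_filter.1 hpr).2] at h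
  · rw [nsmul_eq_mul]
    refine mul_le_mul_of_nonneg_right ?_ (Real.exp_pos _).le
    have h := card_supp2_eq_le (G := G) ℓb P₀ P
    rw [Nat.card_eq_fintype_card, Fintype.card_subtype] at h
    refine le_trans (by exact_mod_cast h) (le_mul_of_one_le_left (by positivity) ?_)
    exact one_le_pow₀ (by norm_num)

end LGT
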